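/- (Analytic core of the main Theorem.) Suppose m ∈ ℝ, q > 0 and C* > 0 satisfy the horizon condition ∫_{C*}^∞ (Q(s) − 3m + 2q²·P(s))·e^{F(s)}/s⁴ ds = 0. Then the strict inequality q/m < 3√2/4 holds; that is, the charge-to-mass ratio of every static, asymptotically flat, spherically symmetric charged scalar-hair black hole in this family is strictly less than 3√2/4 ≈ 1.06066. -/

import Mathlib

open MeasureTheory Real Set Filter

theorem hasDerivAt_integral_Ioi {g : ℝ → ℝ} {a x : ℝ} (hax : a < x)
    (hc : ContinuousOn g (Ioi a)) (hi : IntegrableOn g (Ioi a)) :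
    HasDerivAt (fun y => ∫ s in Ioi y, g s) (-g x) x := by
  have hx : IntervalIntegrable g volume a x :=
    (intervalIntegrable_iff_integrableOn_Ioc_of_le hax.le).2 (hi.mono_set Ioc_subset_Ioi_self)
  have hd := intervalIntegral.integral_hasDerivAt_right hx
    (hc.stronglyMeasurableAtFilter isOpen_Ioi x hax) (hc.continuousAt (Ioi_mem_nhds hax))
  refine (hd.const_sub (∫ s in Ioi a, g s)).congr_of_eventuallyEq ?_
  filter_upwards [Ioi_mem_nhds hax] with y hy
  rw [← intervalIntegral.integral_Ioi_sub_Ioi hi (le_of_lt hy)]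
  ring

theorem integrableOn_Ioi_of_norm_le_rpow {g : ℝ → ℝ} {a c M p : ℝ} (hc : 0 < c) (hac : a ≤ c)
    (hp : p < -1) (hg : ContinuousOn g (Ici a)) (hb : ∀ s, c < s → ‖g s‖ ≤ M * s ^ p) :
    IntegrableOn g (Ioi a) := by
  rw [← Ioc_union_Ioi_eq_Ioi hac]
  refine IntegrableOn.union ?_ ?_
  · exact ((hg.mono Icc_subset_Ici_self).integrableOn_Icc).mono_set Ioc_subset_Icc_self
  · refine Integrable.mono' ((integrableOn_Ioi_rpow_of_lt hp hc).const_mul M) ?_ ?_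
    · exact (hg.mono fun s hs => hac.trans (le_of_lt hs)).aestronglyMeasurable measurableSet_Ioi
    · exact ae_restrict_of_forall_mem measurableSet_Ioi hb

theorem inv_le_integral_Ioi_div_sq {Q g : ℝ → ℝ} {a : ℝ} (ha : 0 < a)
    (hQ : ∀ s ∈ Ici a, HasDerivAt Q (g s) s) (hs : ∀ s ∈ Ici a, s ≤ Q s)
    (hg : ∀ s ∈ Ici a, 0 ≤ g s) (hi : IntegrableOn (fun s => g s / s ^ 2) (Ioi a)) :
    (Q a)⁻¹ ≤ ∫ s in Ioi a, g s / s ^ 2 := by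
  have hpos : ∀ s ∈ Ici a, 0 < Q s := fun s h => (ha.trans_le h).trans_le (hs s h)
  have hd : ∀ s ∈ Ici a, HasDerivAt (fun s => -(Q s)⁻¹) (g s / Q s ^ 2) s := by
    intro s h
    exact ((hQ s h).fun_inv (hpos s h).ne').fun_neg.congr_deriv (by ring)
  have hlim : Tendsto (fun s => -(Q s)⁻¹) atTop (nhds 0) := by
    have : Tendsto Q atTop atTop :=
      tendsto_atTop_mono' _ ((eventually_ge_atTop a).mono hs) tendsto_id
    simpa using this.inv_tendsto_atTop.neg
  have hnn : ∀ s ∈ Ioi a, 0 ≤ g s / Q s ^ 2 := fun s h =>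
    div_nonneg (hg s (mem_Ioi.1 h).le) (sq_nonneg _)
  have hint := integrableOn_Ioi_deriv_of_nonneg' hd hnn hlim
  have heq := integral_Ioi_of_hasDerivAt_of_nonneg' hd hnn hlim
  rw [zero_sub, neg_neg] at heq
  rw [← heq]
  refine setIntegral_mono_on hint hi measurableSet_Ioi fun s h => ?_
  have h0 : 0 < s := ha.trans h
  have h1 := hs s (mem_Ioi.1 h).le
  have h2 := hg s (mem_Ioi.1 h).le
  gcongr

theorem integral_Ioi_sq_mul_le {u : ℝ → ℝ} {α K c : ℝ} (hα : 0 < α) (hc : 0 < c)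
    (hb : ∀ s, c ≤ s → |u s| ≤ K * s ^ (-(3/2 : ℝ) - α))
    (hi : IntegrableOn (fun s => (u s) ^ 2 * s) (Ioi c)) :
    ∫ s in Ioi c, (u s) ^ 2 * s ≤ K ^ 2 / (1 + 2 * α) * c ^ (-1 - 2 * α) := by
  have hp : -2 - 2 * α < -1 := by linarith
  have h := setIntegral_mono_on hi ((integrableOn_Ioi_rpow_of_lt hp hc).const_mul (K ^ 2))
    measurableSet_Ioi (fun s hs => ?_)
  · rw [integral_const_mul, integral_Ioi_rpow_of_lt hp hc] at h
    refine h.trans_eq ?_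
    rw [show -2 - 2 * α + 1 = -(1 + 2 * α) by ring, show -1 - 2 * α = -(1 + 2 * α) by ring,
      neg_div_neg_eq]
    ring
  · have h0 : 0 < s := hc.trans hs
    have h1 := pow_le_pow_left₀ (abs_nonneg _) (hb s (le_of_lt hs)) 2
    rw [sq_abs, mul_pow, ← rpow_natCast (s ^ _), ← rpow_mul h0.le] at h1
    calc (u s) ^ 2 * s ≤ K ^ 2 * s ^ ((-(3/2 : ℝ) - α) * (2 : ℕ)) * s := by gcongr
      _ = K ^ 2 * s ^ (-2 - 2 * α) := by
        rw [mul_assoc, ← rpow_add_one h0.ne']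
        congr 2
        push_cast
        ring

theorem stmt_14
    (α : ℝ) (hα : 0 < α)
    (u : ℝ → ℝ) (hu : ContinuousOn u (Set.Ioi 0))
    (K C₀ : ℝ) (hK : 0 < K) (hC₀ : 0 < C₀)
    (hbound : ∀ C, C₀ ≤ C → |u C| ≤ K * C ^ (-(3/2 : ℝ) - α))
    (hint : ∀ C, 0 < C → MeasureTheory.IntegrableOn (fun s => (u s) ^ 2 * s) (Set.Ioi C))
    (F Q P : ℝ → ℝ)
    (hF : ∀ C, F C = -∫ s in Set.Ioi C, (u s) ^ 2 * s)
    (hQ : ∀ C, Q C = C + ∫ s in Set.Ioi C, (1 - Real.exp (F s)))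
    (hP : ∀ C, P C = ∫ s in Set.Ioi C, Real.exp (F s) / s ^ 2)
    (m q Cs : ℝ) (hq : 0 < q) (hCs : 0 < Cs)
    (hhor : ∫ s in Set.Ioi Cs, (Q s - 3 * m + 2 * q ^ 2 * P s) * Real.exp (F s) / s ^ 4 = 0) :
    q / m < 3 * Real.sqrt 2 / 4 := by
  have hFd : ∀ s, 0 < s → HasDerivAt F (u s ^ 2 * s) s := by
    intro s hs
    have h2 : 0 < s / 2 := half_pos hs
    have h := hasDerivAt_integral_Ioi (g := fun s => u s ^ 2 * s) (half_lt_self hs)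
      (((hu.mono (Ioi_subset_Ioi h2.le)).pow 2).mul continuousOn_id) (hint _ h2)
    rw [funext hF]
    simpa using h.fun_neg
  have hFc : ContinuousOn F (Ioi 0) := fun s hs => (hFd s hs).continuousAt.continuousWithinAt
  have hEc : ContinuousOn (fun s => exp (F s)) (Ioi 0) := hFc.rexp
  have hF0 : ∀ s, 0 < s → F s ≤ 0 := by
    intro s hs
    rw [hF, neg_nonpos]
    exact setIntegral_nonneg measurableSet_Ioi fun t ht =>
      mul_nonneg (sq_nonneg _) (hs.trans ht).le
  have hE1 : ∀ s, 0 < s → exp (F s) ≤ 1 := fun s hs => exp_le_one_iff.2 (hF0 s hs)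
  have hIci : ∀ {a : ℝ}, 0 < a → Ici a ⊆ Ioi 0 := fun ha s hs => ha.trans_le hs
  have hQi : ∀ a, 0 < a → IntegrableOn (fun s => 1 - exp (F s)) (Ioi a) := by
    intro a ha
    refine integrableOn_Ioi_of_norm_le_rpow (c := max a C₀) (M := K ^ 2 / (1 + 2 * α))
      (p := -1 - 2 * α) (lt_max_of_lt_left ha) (le_max_left _ _) (by linarith)
      (continuousOn_const.sub (hEc.mono (hIci ha))) fun s hs => ?_
    have hsa : 0 < s := ha.trans ((le_max_left _ _).trans_lt hs)
    have hsC : C₀ < s := (le_max_right _ _).trans_lt hs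
    have h := integral_Ioi_sq_mul_le hα hsa (fun t ht => hbound t (hsC.le.trans ht)) (hint s hsa)
    rw [Real.norm_of_nonneg (sub_nonneg.2 (hE1 s hsa))]
    linarith [add_one_le_exp (F s), hF s]
  have hPc : ContinuousOn (fun s => exp (F s) / s ^ 2) (Ioi 0) :=
    hEc.div (continuousOn_id.pow 2) fun s hs => (pow_pos hs 2).ne'
  have hPi : ∀ a, 0 < a → IntegrableOn (fun s => exp (F s) / s ^ 2) (Ioi a) := by
    intro a ha
    refine integrableOn_Ioi_of_norm_le_rpow (c := a) (M := 1) (p := -2) ha le_rfl (by norm_num)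
      (hPc.mono (hIci ha)) fun s hs => ?_
    have hs0 : 0 < s := ha.trans hs
    rw [Real.norm_of_nonneg (by positivity), rpow_neg hs0.le, rpow_two, one_mul, div_eq_mul_inv]
    exact mul_le_of_le_one_left (by positivity) (hE1 s hs0)
  have hQd : ∀ s, 0 < s → HasDerivAt Q (exp (F s)) s := by
    intro s hs
    have h2 : 0 < s / 2 := half_pos hs
    have h := hasDerivAt_integral_Ioi (g := fun s => 1 - exp (F s)) (half_lt_self hs)
      (continuousOn_const.sub (hEc.mono (Ioi_subset_Ioi h2.le))) (hQi _ h2)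
    rw [funext hQ]
    simpa using (hasDerivAt_id' s).fun_add h
  have hPcont : ContinuousOn P (Ioi 0) := by
    intro s hs
    have h2 : 0 < s / 2 := half_pos hs
    rw [funext hP]
    exact (hasDerivAt_integral_Ioi (half_lt_self hs) (hPc.mono (Ioi_subset_Ioi h2.le))
      (hPi _ h2)).continuousAt.continuousWithinAt
  have hQcont : ContinuousOn Q (Ioi 0) := fun s hs => (hQd s hs).continuousAt.continuousWithinAt
  have hQs : ∀ s, 0 < s → s ≤ Q s := by
    intro s hs
    rw [hQ, le_add_iff_nonneg_right]
    exact setIntegral_nonneg measurableSet_Ioi fun t ht => sub_nonneg.2 (hE1 t (hs.trans ht))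
  have hQP : ∀ s, 0 < s → (Q s)⁻¹ ≤ P s := by
    intro s hs
    rw [hP]
    exact inv_le_integral_Ioi_div_sq hs (fun t ht => hQd t (hIci hs ht))
      (fun t ht => hQs t (hIci hs ht)) (fun t _ => (exp_pos _).le) (hPi s hs)
  have hP0 : ∀ s, 0 < s → 0 < P s := fun s hs =>
    (inv_pos.2 (hs.trans_le (hQs s hs))).trans_le (hQP s hs)
  have hQle : ∀ s, Cs < s → Q s ≤ s + ∫ t in Ioi Cs, (1 - exp (F t)) := by
    intro s hs
    rw [hQ]
    refine add_le_add le_rfl (setIntegral_mono_set (hQi Cs hCs) ?_ (Ioi_subset_Ioi hs.le).eventuallyLE)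
    exact ae_restrict_of_forall_mem measurableSet_Ioi fun t ht =>
      sub_nonneg.2 (hE1 t (hCs.trans ht))
  have hPle : ∀ s, Cs < s → P s ≤ P Cs := by
    intro s hs
    rw [hP, hP]
    refine setIntegral_mono_set (hPi Cs hCs) ?_ (Ioi_subset_Ioi hs.le).eventuallyLE
    exact Eventually.of_forall fun t => by positivity
  have hM0 : 0 ≤ ∫ t in Ioi Cs, (1 - exp (F t)) :=
    setIntegral_nonneg measurableSet_Ioi fun t ht => sub_nonneg.2 (hE1 t (hCs.trans ht))
  set M := ∫ t in Ioi Cs, (1 - exp (F t))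
  have hcont : ContinuousOn
      (fun s => (Q s - 3 * m + 2 * q ^ 2 * P s) * exp (F s) / s ^ 4) (Ioi 0) :=
    (((hQcont.sub continuousOn_const).add (continuousOn_const.mul hPcont)).mul hEc).div
      (continuousOn_id.pow 4) fun s hs => (pow_pos hs 4).ne'
  have hI : IntegrableOn
      (fun s => (Q s - 3 * m + 2 * q ^ 2 * P s) * exp (F s) / s ^ 4) (Ioi Cs) := by
    set N := M + 3 * |m| + 2 * q ^ 2 * P Cs
    have hN : 0 ≤ N := by have := hP0 Cs hCs; positivity
    refine integrableOn_Ioi_of_norm_le_rpow (c := Cs) (M := 1 + N / Cs) (p := -3) hCs le_rfl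
      (by norm_num) (hcont.mono (hIci hCs)) fun s hs => ?_
    have hs0 : 0 < s := hCs.trans hs
    have h1 : |Q s - 3 * m + 2 * q ^ 2 * P s| ≤ s + N := by
      have hp1 : 2 * q ^ 2 * P s ≤ 2 * q ^ 2 * P Cs := by gcongr; exact hPle s hs
      have hp2 : 0 ≤ 2 * q ^ 2 * P s := by have := hP0 s hs0; positivity
      have hp3 := hP0 Cs hCs
      rw [abs_le]
      constructor <;> linarith [hQs s hs0, hQle s hs, le_abs_self m, neg_abs_le m]
    have h2 : s + N ≤ (1 + N / Cs) * s := by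
      have : N ≤ N / Cs * s := by
        rw [div_mul_eq_mul_div, le_div_iff₀ hCs]
        gcongr
      linarith
    rw [norm_div, norm_mul, Real.norm_of_nonneg (exp_pos _).le,
      Real.norm_of_nonneg (pow_pos hs0 4).le, rpow_neg hs0.le, Real.norm_eq_abs,
      show s ^ (3 : ℝ) = s ^ 3 by exact_mod_cast rpow_natCast s 3, div_le_iff₀ (by positivity)]
    calc |Q s - 3 * m + 2 * q ^ 2 * P s| * exp (F s)
        ≤ |Q s - 3 * m + 2 * q ^ 2 * P s| * 1 := by gcongr; exact hE1 s hs0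
      _ ≤ (1 + N / Cs) * s := by linarith
      _ = (1 + N / Cs) * (s ^ 3)⁻¹ * s ^ 4 := by field_simp
  have hamgm : ∀ s, 0 < s → 2 * √2 * q ≤ Q s + 2 * q ^ 2 * P s := by
    intro s hs
    have hQ0 : 0 < Q s := hs.trans_le (hQs s hs)
    have h1 : 2 * q ^ 2 * (Q s)⁻¹ ≤ 2 * q ^ 2 * P s := by gcongr; exact hQP s hs
    have h2 : 2 * √2 * q ≤ Q s + 2 * q ^ 2 * (Q s)⁻¹ := by
      rw [← sub_nonneg, show Q s + 2 * q ^ 2 * (Q s)⁻¹ - 2 * √2 * q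
        = (Q s - √2 * q) ^ 2 / Q s by
          field_simp
          linear_combination -q ^ 2 * Real.sq_sqrt (zero_le_two (α := ℝ))]
      positivity
    linarith
  have hm : 2 * √2 * q < 3 * m := by
    by_contra! hle
    refine hhor.not_gt ((setIntegral_pos_iff_support_of_nonneg_ae ?_ hI).2 ?_)
    · refine ae_restrict_of_forall_mem measurableSet_Ioi fun s hs => ?_
      have hs0 : 0 < s := hCs.trans hs
      have : 0 ≤ Q s - 3 * m + 2 * q ^ 2 * P s := by linarith [hamgm s hs0]
      simp only [Pi.zero_apply]
      positivity
    · have hsub : Ioi (max Cs (3 * m)) ⊆ Function.support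
          (fun s => (Q s - 3 * m + 2 * q ^ 2 * P s) * exp (F s) / s ^ 4) ∩ Ioi Cs := by
        intro s hs
        obtain ⟨hs1, hs2⟩ := max_lt_iff.1 (mem_Ioi.1 hs)
        have hs0 : 0 < s := hCs.trans hs1
        have hp := hP0 s hs0
        have h1 : 0 < Q s - 3 * m := by linarith [hQs s hs0]
        refine ⟨ne_of_gt ?_, hs1⟩
        positivity
      exact lt_of_lt_of_le (by simp) (measure_mono hsub)
  have hs2 : √2 * √2 = 2 := Real.mul_self_sqrt zero_le_two
  have hs0 : 0 < √2 := by positivity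
  have hm0 : 0 < m := by nlinarith [mul_pos hs0 hq]
  rw [div_lt_iff₀ hm0]
  nlinarith [mul_lt_mul_of_pos_left hm hs0]
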